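/- arXiv:2604.14211 — 2 statements merged into one kernel-verified Lean document; each statement's English description precedes it below -/
import Mathlib

section
/- Let G be a locally finite connected graph and let x,y ∈ V(G) be distinct vertices. Then the limit lim_{α → 1⁻} Ric_α(x,y)/(1 − α) exists (and is finite); this limit is the Lin–Lu–Yau Ricci curvature Ric_LLY(x,y). -/
namespace ORC

variable {V : Type*}

/-- A coupling of two finitely supported probability distributions `μ` and `ν` on `V`:
a matrix `A : V × V → [0,1]` with finite support whose row sums are `μ` and column sums
are `ν`. -/
def IsCoupling (μ ν : V → ℝ) (A : V → V → ℝ) : Prop :=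
  (∀ u v, 0 ≤ A u v ∧ A u v ≤ 1) ∧
  (Function.support fun p : V × V => A p.1 p.2).Finite ∧
  (∀ u, ∑ᶠ v, A u v = μ u) ∧
  (∀ v, ∑ᶠ u, A u v = ν v)

/-- The 1-Wasserstein distance between finitely supported distributions `μ`, `ν` with
respect to the distance `d`: the infimum over couplings `A` of `Σ A(u,v) d(u,v)`. -/
noncomputable def W1 (d : V → V → ℝ) (μ ν : V → ℝ) : ℝ :=
  sInf {c | ∃ A : V → V → ℝ, IsCoupling μ ν A ∧ c = ∑ᶠ (u : V) (v : V), A u v * d u v}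

/-- The graph (shortest-path) distance, as a real number. -/
noncomputable def gdist (G : SimpleGraph V) : V → V → ℝ := fun u v => (G.dist u v : ℝ)

open scoped Classical in
/-- The Lin–Lu–Yau measure `m_x^α`: mass `α` at `x`, mass `(1-α)/d_x` at each neighbor of
`x`, and `0` elsewhere. -/
noncomputable def mAlpha (G : SimpleGraph V) [∀ v, Fintype (G.neighborSet v)]
    (α : ℝ) (x : V) : V → ℝ := fun v =>
  if v = x then α else if G.Adj x v then (1 - α) / (G.degree x : ℝ) else 0

/-- The `α`-Ricci curvature `Ric_α(x,y) = 1 - W1(m_x^α, m_y^α)/d(x,y)`. -/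
noncomputable def ricAlpha (G : SimpleGraph V) [∀ v, Fintype (G.neighborSet v)]
    (α : ℝ) (x y : V) : ℝ :=
  1 - W1 (gdist G) (mAlpha G α x) (mAlpha G α y) / gdist G x y

end ORC

open ORC

namespace ORC

variable {V : Type*}

theorem finsum_finsum_eq_sum {F : V → V → ℝ} {S : Finset V}
    (h : ∀ u v, F u v ≠ 0 → u ∈ S ∧ v ∈ S) :
    ∑ᶠ (u : V) (v : V), F u v = ∑ u ∈ S, ∑ v ∈ S, F u v := by
  have inner (u : V) : ∑ᶠ v, F u v = ∑ v ∈ S, F u v :=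
    finsum_eq_sum_of_support_subset _ fun v hv => (h u v hv).2
  simp only [inner]
  refine finsum_eq_sum_of_support_subset _ fun u hu => ?_
  obtain ⟨v, -, hv⟩ := Finset.exists_ne_zero_of_sum_ne_zero hu
  exact (h u v hv).1

/-- A coupling is carried by the square of a finite set, over which all the sums in its
definition may be taken. -/
theorem IsCoupling.exists_finset {μ ν : V → ℝ} {A : V → V → ℝ} (hA : IsCoupling μ ν A) :
    ∃ S : Finset V, (∀ u v, A u v ≠ 0 → u ∈ S ∧ v ∈ S) ∧
      (∀ u, ∑ v ∈ S, A u v = μ u) ∧ (∀ v, ∑ u ∈ S, A u v = ν v) := by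
  classical
  obtain ⟨-, hfin, hrow, hcol⟩ := hA
  have hS : ∀ u v, A u v ≠ 0 → u ∈ hfin.toFinset.image Prod.fst ∪ hfin.toFinset.image Prod.snd ∧
      v ∈ hfin.toFinset.image Prod.fst ∪ hfin.toFinset.image Prod.snd := by
    intro u v huv
    have hmem : (u, v) ∈ hfin.toFinset := hfin.mem_toFinset.2 huv
    exact ⟨Finset.mem_union_left _ (Finset.mem_image_of_mem Prod.fst hmem),
      Finset.mem_union_right _ (Finset.mem_image_of_mem Prod.snd hmem)⟩
  refine ⟨_, hS, fun u => ?_, fun v => ?_⟩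
  · rw [← hrow u]
    exact (finsum_eq_sum_of_support_subset _ fun v hv => (hS u v hv).2).symm
  · rw [← hcol v]
    exact (finsum_eq_sum_of_support_subset _ fun u hu => (hS u v hu).1).symm

theorem IsCoupling.prod {μ ν : V → ℝ} (hμ : ∀ v, 0 ≤ μ v ∧ μ v ≤ 1) (hν : ∀ v, 0 ≤ ν v ∧ ν v ≤ 1)
    (hμfin : μ.support.Finite) (hνfin : ν.support.Finite)
    (hμsum : ∑ᶠ v, μ v = 1) (hνsum : ∑ᶠ v, ν v = 1) :
    IsCoupling μ ν fun u v => μ u * ν v := by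
  refine ⟨fun u v => ⟨mul_nonneg (hμ u).1 (hν v).1,
    mul_le_one₀ (hμ u).2 (hν v).1 (hν v).2⟩, (hμfin.prod hνfin).subset ?_, fun u => ?_, fun v => ?_⟩
  · rintro ⟨u, v⟩ h
    exact ⟨left_ne_zero_of_mul h, right_ne_zero_of_mul h⟩
  · beta_reduce
    rw [← mul_finsum' _ _ hνfin, hνsum, mul_one]
  · beta_reduce
    rw [← finsum_mul' _ _ hμfin, hμsum, one_mul]

open scoped Classical in
/-- Mixing a coupling with the point mass at a pair `(x, y)`. -/
theorem IsCoupling.mix_single {μ ν : V → ℝ} {A : V → V → ℝ} (hA : IsCoupling μ ν A)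
    (d : V → V → ℝ) (x y : V) {s : ℝ} (hs₀ : 0 ≤ s) (hs₁ : s ≤ 1) :
    ∃ B, IsCoupling (fun u => s * μ u + (1 - s) * if u = x then 1 else 0)
        (fun v => s * ν v + (1 - s) * if v = y then 1 else 0) B ∧
      ∑ᶠ (u : V) (v : V), B u v * d u v =
        s * ∑ᶠ (u : V) (v : V), A u v * d u v + (1 - s) * d x y := by
  obtain ⟨S, hS, hrow, hcol⟩ := hA.exists_finset
  set T : Finset V := insert x (insert y S) with hT
  have hx : x ∈ T := by simp [hT]
  have hy : y ∈ T := by simp [hT]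
  have hST : S ⊆ T := fun u hu => by simp [hT, hu]
  have hAT : ∀ u v, A u v ≠ 0 → u ∈ T ∧ v ∈ T := fun u v h =>
    ⟨hST (hS u v h).1, hST (hS u v h).2⟩
  have hrowT (u : V) : ∑ v ∈ T, A u v = μ u := by
    rw [← hrow u]
    exact (Finset.sum_subset hST fun v _ hv => by_contra fun h => hv (hS u v h).2).symm
  have hcolT (v : V) : ∑ u ∈ T, A u v = ν v := by
    rw [← hcol v]
    exact (Finset.sum_subset hST fun u _ hu => by_contra fun h => hu (hS u v h).1).symm
  set B : V → V → ℝ := fun u v =>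
    s * A u v + (1 - s) * ((if u = x then 1 else 0) * if v = y then 1 else 0) with hB
  have hBT : ∀ u v, B u v ≠ 0 → u ∈ T ∧ v ∈ T := by
    intro u v h
    by_cases hA0 : A u v = 0
    · by_cases hu : u = x
      · by_cases hv : v = y
        · exact ⟨hu ▸ hx, hv ▸ hy⟩
        · simp [hB, hA0, hv] at h
      · simp [hB, hA0, hu] at h
    · exact hAT u v hA0
  refine ⟨B, ⟨fun u v => ?_, ?_, fun u => ?_, fun v => ?_⟩, ?_⟩
  · obtain ⟨h0, h1⟩ := hA.1 u v
    have hδ : (0 : ℝ) ≤ (if u = x then 1 else 0) * (if v = y then 1 else 0) ∧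
        ((if u = x then 1 else 0) * (if v = y then 1 else 0) : ℝ) ≤ 1 := by
      split_ifs <;> norm_num
    simp only [hB]
    constructor
    · exact add_nonneg (mul_nonneg hs₀ h0) (mul_nonneg (by linarith) hδ.1)
    · nlinarith [mul_le_mul_of_nonneg_left h1 hs₀,
        mul_le_mul_of_nonneg_left hδ.2 (sub_nonneg.2 hs₁)]
  · refine (T ×ˢ T).finite_toSet.subset fun p hp => ?_
    exact Finset.mem_coe.2 (Finset.mem_product.2 (hBT p.1 p.2 hp))
  · rw [finsum_eq_sum_of_support_subset (s := T) _ fun v hv => (hBT u v hv).2]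
    simp [hB, Finset.sum_add_distrib, ← Finset.mul_sum, hrowT, hy]
  · rw [finsum_eq_sum_of_support_subset (s := T) _ fun u hu => (hBT u v hu).1]
    simp [hB, Finset.sum_add_distrib, ← Finset.mul_sum, hcolT, hx]
  · rw [finsum_finsum_eq_sum fun u v h => hBT u v (left_ne_zero_of_mul h),
      finsum_finsum_eq_sum fun u v h => hAT u v (left_ne_zero_of_mul h)]
    simp [hB, add_mul, Finset.sum_add_distrib, mul_assoc, ← Finset.mul_sum, hx, hy]

section W1

variable {d : V → V → ℝ} {μ ν : V → ℝ}

theorem W1_le_of_isCoupling (hd : ∀ u v, 0 ≤ d u v) {A : V → V → ℝ} (hA : IsCoupling μ ν A) :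
    W1 d μ ν ≤ ∑ᶠ (u : V) (v : V), A u v * d u v := by
  refine csInf_le ⟨0, ?_⟩ ⟨A, hA, rfl⟩
  rintro _ ⟨B, hB, rfl⟩
  exact finsum_nonneg fun u => finsum_nonneg fun v => mul_nonneg (hB.1 u v).1 (hd u v)

theorem le_W1 {c : ℝ} (hne : ∃ A, IsCoupling μ ν A)
    (h : ∀ A, IsCoupling μ ν A → c ≤ ∑ᶠ (u : V) (v : V), A u v * d u v) : c ≤ W1 d μ ν := by
  obtain ⟨A, hA⟩ := hne
  refine le_csInf ⟨_, A, hA, rfl⟩ ?_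
  rintro _ ⟨B, hB, rfl⟩
  exact h B hB

open scoped Classical in
theorem W1_mix_single_le (hd : ∀ u v, 0 ≤ d u v) (hne : ∃ A, IsCoupling μ ν A) (x y : V)
    {s : ℝ} (hs₀ : 0 < s) (hs₁ : s ≤ 1) :
    W1 d (fun u => s * μ u + (1 - s) * if u = x then 1 else 0)
        (fun v => s * ν v + (1 - s) * if v = y then 1 else 0) ≤
      s * W1 d μ ν + (1 - s) * d x y := by
  rw [← sub_le_iff_le_add, ← div_le_iff₀' hs₀]
  refine le_W1 hne fun A hA => ?_
  obtain ⟨B, hB, hcost⟩ := hA.mix_single d x y hs₀.le hs₁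
  rw [div_le_iff₀' hs₀, sub_le_iff_le_add, ← hcost]
  exact W1_le_of_isCoupling hd hB

/-- A cost bounded below by `f u + g v` makes every transport cost at least `∫ f dμ + ∫ g dν`. -/
theorem IsCoupling.le_cost {A : V → V → ℝ} (hA : IsCoupling μ ν A) {f g : V → ℝ}
    (h : ∀ u v, f u + g v ≤ d u v) :
    ∑ᶠ u, μ u * f u + ∑ᶠ v, ν v * g v ≤ ∑ᶠ (u : V) (v : V), A u v * d u v := by
  obtain ⟨S, hS, hrow, hcol⟩ := hA.exists_finset
  have hμ : ∑ᶠ u, μ u * f u = ∑ u ∈ S, μ u * f u := by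
    refine finsum_eq_sum_of_support_subset _ fun u hu => ?_
    obtain ⟨v, -, hv⟩ := Finset.exists_ne_zero_of_sum_ne_zero
      ((hrow u).trans_ne (left_ne_zero_of_mul hu))
    exact (hS u v hv).1
  have hν : ∑ᶠ v, ν v * g v = ∑ v ∈ S, ν v * g v := by
    refine finsum_eq_sum_of_support_subset _ fun v hv => ?_
    obtain ⟨u, -, hu⟩ := Finset.exists_ne_zero_of_sum_ne_zero
      ((hcol v).trans_ne (left_ne_zero_of_mul hv))
    exact (hS u v hu).2
  rw [finsum_finsum_eq_sum fun u v h => hS u v (left_ne_zero_of_mul h), hμ, hν]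
  simp only [← hrow, ← hcol, Finset.sum_mul]
  rw [Finset.sum_comm (f := fun v u => A u v * g v), ← Finset.sum_add_distrib]
  refine Finset.sum_le_sum fun u _ => ?_
  rw [← Finset.sum_add_distrib]
  refine Finset.sum_le_sum fun v _ => ?_
  rw [← mul_add]
  exact mul_le_mul_of_nonneg_left (h u v) (hA.1 u v).1

end W1

section mAlpha

variable (G : SimpleGraph V) [∀ v, Fintype (G.neighborSet v)]

theorem mAlpha_mem_Icc {α : ℝ} (h₀ : 0 ≤ α) (h₁ : α ≤ 1) (x v : V) :
    0 ≤ mAlpha G α x v ∧ mAlpha G α x v ≤ 1 := by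
  unfold mAlpha
  split_ifs with h h'
  · exact ⟨h₀, h₁⟩
  · have hdeg : (1 : ℝ) ≤ G.degree x := by
      exact_mod_cast (G.degree_pos_iff_exists_adj x).2 ⟨v, h'⟩
    refine ⟨div_nonneg (by linarith) (by linarith), ?_⟩
    rw [div_le_one (by linarith)]
    linarith
  · exact ⟨le_rfl, zero_le_one⟩

open scoped Classical in
theorem support_mAlpha_subset (α : ℝ) (x : V) :
    (mAlpha G α x).support ⊆ ↑(insert x (G.neighborFinset x)) := by
  intro v hv
  by_contra h
  simp only [Finset.coe_insert, Set.mem_insert_iff, Finset.mem_coe, SimpleGraph.mem_neighborFinset,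
    not_or] at h
  exact hv (by simp [mAlpha, h])

theorem finsum_mAlpha_mul {x : V} (hx : 0 < G.degree x) (α c : ℝ) {f : V → ℝ}
    (hf : ∀ v, G.Adj x v → f v = c) :
    ∑ᶠ v, mAlpha G α x v * f v = α * f x + (1 - α) * c := by
  classical
  rw [finsum_eq_sum_of_support_subset _
      ((Function.support_mul_subset_left _ _).trans (support_mAlpha_subset G α x)),
    Finset.sum_insert (by simp)]
  have hsum : ∑ v ∈ G.neighborFinset x, mAlpha G α x v * f v =
      ∑ v ∈ G.neighborFinset x, (1 - α) / (G.degree x : ℝ) * c := by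
    refine Finset.sum_congr rfl fun v hv => ?_
    rw [SimpleGraph.mem_neighborFinset] at hv
    rw [hf v hv]
    simp [mAlpha, hv, hv.ne']
  have hdeg : (G.degree x : ℝ) ≠ 0 := by exact_mod_cast hx.ne'
  rw [hsum, Finset.sum_const, G.card_neighborFinset_eq_degree, nsmul_eq_mul]
  simp only [mAlpha, if_true]
  field_simp

theorem exists_isCoupling_mAlpha {x y : V} (hx : 0 < G.degree x) (hy : 0 < G.degree y)
    {α : ℝ} (h₀ : 0 ≤ α) (h₁ : α ≤ 1) :
    ∃ A, IsCoupling (mAlpha G α x) (mAlpha G α y) A := by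
  classical
  have hfin (z : V) : (mAlpha G α z).support.Finite :=
    (Finset.finite_toSet _).subset (support_mAlpha_subset G α z)
  have hsum {z : V} (hz : 0 < G.degree z) : ∑ᶠ v, mAlpha G α z v = 1 := by
    simpa using finsum_mAlpha_mul G hz α 1 (f := fun _ => 1) fun _ _ => rfl
  exact ⟨_, .prod (mAlpha_mem_Icc G h₀ h₁ x) (mAlpha_mem_Icc G h₀ h₁ y) (hfin x) (hfin y)
    (hsum hx) (hsum hy)⟩

open scoped Classical in
/-- A lazier measure is a mixture of a less lazy one with a point mass. -/
theorem mAlpha_eq_mix {α β : ℝ} (hα : α < 1) (x : V) :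
    mAlpha G β x = fun v => (1 - β) / (1 - α) * mAlpha G α x v +
      (1 - (1 - β) / (1 - α)) * if v = x then 1 else 0 := by
  have h : 1 - α ≠ 0 := by linarith
  funext v
  unfold mAlpha
  split_ifs
  · field_simp
    ring
  · field_simp
    ring
  · ring

theorem W1_mAlpha_le {x y : V} (hx : 0 < G.degree x) (hy : 0 < G.degree y)
    {α β : ℝ} (h₀ : 0 ≤ α) (hαβ : α ≤ β) (hβ : β < 1) :
    W1 (gdist G) (mAlpha G β x) (mAlpha G β y) ≤
      (1 - β) / (1 - α) * W1 (gdist G) (mAlpha G α x) (mAlpha G α y) +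
        (1 - (1 - β) / (1 - α)) * gdist G x y := by
  have hα : α < 1 := hαβ.trans_lt hβ
  rw [mAlpha_eq_mix G hα x, mAlpha_eq_mix G hα y]
  refine W1_mix_single_le (fun u v => Nat.cast_nonneg _)
    (exists_isCoupling_mAlpha G hx hy h₀ hα.le) x y (div_pos ?_ ?_) ?_
  · linarith
  · linarith
  · rw [div_le_one (by linarith)]
    linarith

theorem gdist_sub_le_W1_mAlpha (hconn : G.Connected) {x y : V} (hx : 0 < G.degree x)
    (hy : 0 < G.degree y) {α : ℝ} (h₀ : 0 ≤ α) (h₁ : α ≤ 1) :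
    gdist G x y - 2 * (1 - α) ≤ W1 (gdist G) (mAlpha G α x) (mAlpha G α y) := by
  refine le_W1 (exists_isCoupling_mAlpha G hx hy h₀ h₁) fun A hA => ?_
  have htri : ∀ u v, (gdist G x y - gdist G x u) + -gdist G y v ≤ gdist G u v := by
    intro u v
    have h1 : G.dist x y ≤ G.dist x u + G.dist u y := hconn.dist_triangle
    have h2 : G.dist u y ≤ G.dist u v + G.dist v y := hconn.dist_triangle
    rw [G.dist_comm (u := v)] at h2
    have h3 : (G.dist x y : ℝ) ≤ G.dist x u + (G.dist u v + G.dist y v) := by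
      exact_mod_cast h1.trans (by omega)
    simp only [gdist]
    linarith
  have hadj {z v : V} (h : G.Adj z v) : gdist G z v = 1 := by
    simp [gdist, SimpleGraph.dist_eq_one_iff_adj.2 h]
  have hself (z : V) : gdist G z z = 0 := by simp [gdist]
  have hcost := hA.le_cost htri
  rw [finsum_mAlpha_mul G hx α (gdist G x y - 1) fun v hv => by rw [hadj hv],
    finsum_mAlpha_mul G hy α (-1) fun v hv => by rw [hadj hv], hself, hself] at hcost
  linarith

theorem monotoneOn_ricAlpha_div {x y : V} (hx : 0 < G.degree x) (hy : 0 < G.degree y)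
    (hd : 0 < gdist G x y) :
    MonotoneOn (fun α => ricAlpha G α x y / (1 - α)) (Set.Ico 0 1) := by
  intro α hα β hβ hαβ
  have hW := W1_mAlpha_le G hx hy hα.1 hαβ hβ.2
  have h1α : 0 < 1 - α := by linarith [hα.2]
  have h1β : 0 < 1 - β := by linarith [hβ.2]
  simp only [ricAlpha]
  rw [div_le_div_iff₀ h1α h1β, ← mul_le_mul_iff_right₀ hd]
  field_simp at hW ⊢
  linarith

theorem ricAlpha_div_le (hconn : G.Connected) {x y : V} (hx : 0 < G.degree x)
    (hy : 0 < G.degree y) (hd : 0 < gdist G x y) {α : ℝ} (hα : α ∈ Set.Ico (0 : ℝ) 1) :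
    ricAlpha G α x y / (1 - α) ≤ 2 / gdist G x y := by
  have hW := gdist_sub_le_W1_mAlpha G hconn hx hy hα.1 hα.2.le
  have h1α : 0 < 1 - α := by linarith [hα.2]
  rw [div_le_div_iff₀ h1α hd, ricAlpha]
  field_simp
  linarith

end mAlpha

end ORC

/-- For distinct vertices `x, y` of a locally finite connected graph, the limit
`lim_{α → 1⁻} Ric_α(x,y)/(1-α)` exists and is finite (this is the Lin–Lu–Yau Ricci
curvature). -/
theorem ricLLY_limit_exists {V : Type*} (G : SimpleGraph V)
    [∀ v, Fintype (G.neighborSet v)] (hconn : G.Connected) (x y : V) (hxy : x ≠ y) :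
    ∃ L : ℝ, Filter.Tendsto (fun α : ℝ => ricAlpha G α x y / (1 - α))
      (nhdsWithin 1 (Set.Ico 0 1)) (nhds L) := by
  have : Nontrivial V := ⟨x, y, hxy⟩
  have hdeg (z : V) : 0 < G.degree z := hconn.preconnected.degree_pos_of_nontrivial z
  have hd : 0 < gdist G x y := Nat.cast_pos.2 (hconn.pos_dist_of_ne hxy)
  have hmono := (monotoneOn_ricAlpha_div G (hdeg x) (hdeg y) hd).mono Set.Ioo_subset_Ico_self
  have hbdd : BddAbove ((fun α => ricAlpha G α x y / (1 - α)) '' Set.Ioo 0 1) := by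
    refine ⟨2 / gdist G x y, ?_⟩
    rintro _ ⟨α, hα, rfl⟩
    exact ricAlpha_div_le G hconn (hdeg x) (hdeg y) hd (Set.Ioo_subset_Ico_self hα)
  rw [nhdsWithin_Ico_eq_nhdsLT zero_lt_one]
  exact ⟨_, hmono.tendsto_nhdsWithin_Ioo_left (Set.nonempty_Ioo.2 zero_lt_one) hbdd⟩
end

section
/- Let G be a locally finite connected graph and let x,y ∈ V(G) be adjacent vertices. Let #(x,y) denote the number of common neighbors of x and y (equivalently, the number of triangles containing the edge xy). Then the Ollivier–Ricci curvature of the edge xy satisfies Ric(x,y) ≥ −(1 − 1/d_x − 1/d_y − #(x,y)/(d_x ∧ d_y))_+ − (1 − 1/d_x − 1/d_y − #(x,y)/(d_x ∨ d_y))_+ + #(x,y)/(d_x ∨ d_y), where d_x ∧ d_y = min{d_x, d_y} and d_x ∨ d_y = max{d_x, d_y}. -/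
namespace ORC

variable {V : Type*}

open scoped Classical in
/-- The uniform nearest-neighbor measure `m_x`: mass `1/d_x` at each neighbor of `x` and
`0` elsewhere. -/
noncomputable def mUnif (G : SimpleGraph V) [∀ v, Fintype (G.neighborSet v)]
    (x : V) : V → ℝ := fun v =>
  if G.Adj x v then 1 / (G.degree x : ℝ) else 0

/-- The Ollivier–Ricci curvature of an edge `xy` (so `d(x,y) = 1`) with respect to the
uniform nearest-neighbor measures: `Ric(x,y) = 1 - W1(m_x, m_y)`. -/
noncomputable def ricEdge (G : SimpleGraph V) [∀ v, Fintype (G.neighborSet v)]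
    (x y : V) : ℝ :=
  1 - W1 (gdist G) (mUnif G x) (mUnif G y)

end ORC

open ORC

namespace ORC

/-- `μ` can be transported to `ν` by a plan supported on `S × S` of total cost at most `c`. -/
def HasTransport {V : Type*} (S : Finset V) (d : V → V → ℝ) (μ ν : V → ℝ) (c : ℝ) : Prop :=
  ∃ A : V → V → ℝ, (∀ u v, 0 ≤ A u v) ∧ (∀ u v, A u v ≠ 0 → u ∈ S ∧ v ∈ S) ∧
    (∀ u, ∑ v ∈ S, A u v = μ u) ∧ (∀ v, ∑ u ∈ S, A u v = ν v) ∧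
    ∑ u ∈ S, ∑ v ∈ S, A u v * d u v ≤ c

namespace HasTransport

variable {V : Type*} {S : Finset V} {d : V → V → ℝ} {μ ν μ' ν' : V → ℝ} {c c' : ℝ}

lemma add (h : HasTransport S d μ ν c) (h' : HasTransport S d μ' ν' c') :
    HasTransport S d (μ + μ') (ν + ν') (c + c') := by
  obtain ⟨A, hA, hS, hr, hc, hcost⟩ := h
  obtain ⟨B, hB, hS', hr', hc', hcost'⟩ := h'
  refine ⟨A + B, fun u v => add_nonneg (hA u v) (hB u v), fun u v huv => ?_, fun u => ?_,
    fun v => ?_, ?_⟩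
  · by_cases h0 : A u v = 0
    · exact hS' u v fun h1 => huv (by simp [h0, h1])
    · exact hS u v h0
  · simp [Finset.sum_add_distrib, hr, hr']
  · simp [Finset.sum_add_distrib, hc, hc']
  · simp only [Pi.add_apply, add_mul, Finset.sum_add_distrib]
    exact add_le_add hcost hcost'

lemma mono (h : HasTransport S d μ ν c) (hcc : c ≤ c') : HasTransport S d μ ν c' := by
  obtain ⟨A, hA, hS, hr, hc, hcost⟩ := h
  exact ⟨A, hA, hS, hr, hc, hcost.trans hcc⟩

lemma symm (hd : ∀ u v, d u v = d v u) (h : HasTransport S d μ ν c) :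
    HasTransport S d ν μ c := by
  obtain ⟨A, hA, hS, hr, hc, hcost⟩ := h
  refine ⟨fun u v => A v u, fun u v => hA v u, fun u v huv => (hS v u huv).symm, hc, hr, ?_⟩
  rw [Finset.sum_comm]
  simpa only [fun u v => hd v u] using hcost

lemma W1_le (hd : ∀ u v, 0 ≤ d u v) (hμ : ∀ u, μ u ≤ 1) (h : HasTransport S d μ ν c) :
    W1 d μ ν ≤ c := by
  obtain ⟨A, hA, hS, hr, hc, hcost⟩ := h
  have hrow (f : V → ℝ) (u : V) : ∑ᶠ v, A u v * f v = ∑ v ∈ S, A u v * f v :=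
    finsum_eq_sum_of_support_subset _ fun v hv => (hS u v (left_ne_zero_of_mul hv)).2
  have hbdd : BddBelow {c | ∃ A : V → V → ℝ, IsCoupling μ ν A ∧
      c = ∑ᶠ (u : V) (v : V), A u v * d u v} := by
    refine ⟨0, ?_⟩
    rintro _ ⟨B, hB, rfl⟩
    exact finsum_nonneg fun u => finsum_nonneg fun v => mul_nonneg (hB.1 u v).1 (hd u v)
  refine (csInf_le hbdd ⟨A, ⟨fun u v => ⟨hA u v, ?_⟩, ?_, fun u => ?_, fun v => ?_⟩,
    rfl⟩).trans ?_
  · by_cases h0 : A u v = 0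
    · simp [h0]
    · exact (Finset.single_le_sum (fun w _ => hA u w) (hS u v h0).2).trans ((hr u).trans_le (hμ u))
  · exact (S ×ˢ S).finite_toSet.subset fun p hp => by
      simpa using hS p.1 p.2 hp
  · simpa [hr u] using hrow 1 u
  · rw [← hc v]
    exact finsum_eq_sum_of_support_subset _ fun u hu => (hS u v hu).1
  · simp only [hrow]
    rw [finsum_eq_sum_of_support_subset (s := S)]
    · exact hcost
    · intro u hu
      obtain ⟨v, -, hv⟩ := Finset.exists_ne_zero_of_sum_ne_zero hu
      exact (hS u v (left_ne_zero_of_mul hv)).1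

end HasTransport

/-- The uniform distribution of total mass `m` on a finite set `P`. -/
noncomputable def unifMass {V : Type*} [DecidableEq V] (P : Finset V) (m : ℝ) : V → ℝ :=
  fun u => if u ∈ P then m / P.card else 0

section unifMass

variable {V : Type*} [DecidableEq V] {S P Q : Finset V} {d : V → V → ℝ} {m : ℝ}

lemma sum_unifMass (hP : P ⊆ S) (hm : m ≠ 0 → P.Nonempty) : ∑ u ∈ S, unifMass P m u = m := by
  simp only [unifMass, Finset.sum_ite_mem, Finset.inter_eq_right.2 hP, Finset.sum_const,
    nsmul_eq_mul]
  by_cases h0 : m = 0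
  · simp [h0]
  · have : (P.card : ℝ) ≠ 0 := by exact_mod_cast (hm h0).card_ne_zero
    field_simp

lemma unifMass_nonneg (hm : 0 ≤ m) (u : V) : 0 ≤ unifMass P m u := by
  unfold unifMass
  split_ifs <;> positivity

lemma hasTransport_unifMass_self (hd : ∀ u, d u u = 0) (hP : P ⊆ S) (hm : 0 ≤ m) :
    HasTransport S d (unifMass P m) (unifMass P m) 0 := by
  have hz (u : V) (hu : u ∉ S) : unifMass P m u = 0 := if_neg fun h => hu (hP h)
  refine ⟨fun u v => if u = v then unifMass P m u else 0, fun u v => ?_, fun u v huv => ?_,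
    fun u => ?_, fun v => ?_, ?_⟩
  · dsimp only
    split_ifs
    exacts [unifMass_nonneg hm u, le_rfl]
  · obtain ⟨rfl, h⟩ : u = v ∧ unifMass P m u ≠ 0 := by simpa using huv
    have : u ∈ S := by_contra fun hu => h (hz u hu)
    exact ⟨this, this⟩
  · simpa using fun hu => (hz u hu).symm
  · simpa using fun hu => (hz v hu).symm
  · refine (Finset.sum_eq_zero fun u _ => Finset.sum_eq_zero fun v _ => ?_).le
    by_cases h : u = v <;> simp [h, hd]

lemma hasTransport_unifMass (hP : P ⊆ S) (hQ : Q ⊆ S) (hm : 0 ≤ m)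
    (hPm : m ≠ 0 → P.Nonempty) (hQm : m ≠ 0 → Q.Nonempty) {k : ℝ}
    (hk : ∀ u ∈ P, ∀ v ∈ Q, d u v ≤ k) :
    HasTransport S d (unifMass P m) (unifMass Q m) (m * k) := by
  have hself (x : ℝ) (hx : m = 0 → x = 0) : x * m / m = x := by
    by_cases h : m = 0
    · simp [hx h, h]
    · field_simp
  refine ⟨fun u v => unifMass P m u * unifMass Q m v / m, fun u v => ?_, fun u v huv => ?_,
    fun u => ?_, fun v => ?_, ?_⟩
  · exact div_nonneg (mul_nonneg (unifMass_nonneg hm u) (unifMass_nonneg hm v)) hm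
  · constructor <;> by_contra h <;> apply huv
    · simp [show unifMass P m u = 0 from if_neg fun h' => h (hP h')]
    · simp [show unifMass Q m v = 0 from if_neg fun h' => h (hQ h')]
  · rw [← Finset.sum_div, ← Finset.mul_sum, sum_unifMass hQ hQm]
    exact hself _ fun h => by simp [unifMass, h]
  · rw [← Finset.sum_div, ← Finset.sum_mul, sum_unifMass hP hPm, mul_comm]
    exact hself _ fun h => by simp [unifMass, h]
  · calc
      _ ≤ ∑ u ∈ S, ∑ v ∈ S, unifMass P m u * unifMass Q m v / m * k := by
        refine Finset.sum_le_sum fun u _ => Finset.sum_le_sum fun v _ => ?_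
        by_cases hu : u ∈ P
        · by_cases hv : v ∈ Q
          · exact mul_le_mul_of_nonneg_left (hk u hu v hv) (div_nonneg
              (mul_nonneg (unifMass_nonneg hm u) (unifMass_nonneg hm v)) hm)
          · simp [unifMass, hv]
        · simp [unifMass, hu]
      _ = m * k := by
        simp_rw [← Finset.sum_mul, ← Finset.sum_div, ← Finset.mul_sum, sum_unifMass hQ hQm,
          ← Finset.sum_mul, sum_unifMass hP hPm]
        rw [hself m id]

end unifMass

lemma mUnif_le_one {V : Type*} {G : SimpleGraph V} [∀ v, Fintype (G.neighborSet v)] {x : V}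
    (u : V) : mUnif G x u ≤ 1 := by
  unfold mUnif
  split_ifs with h
  · have : 0 < G.degree x := (G.degree_pos_iff_exists_adj x).2 ⟨u, h⟩
    rw [div_le_one (by exact_mod_cast this)]
    exact_mod_cast this
  · exact zero_le_one

section Edge

variable {V : Type*} [DecidableEq V] {G : SimpleGraph V} [∀ v, Fintype (G.neighborSet v)]
  {x y : V}

lemma card_private_neighbors (hadj : G.Adj x y) :
    (((G.neighborFinset x \ G.neighborFinset y).erase y).card : ℝ)
      = G.degree x - 1 - (G.neighborFinset x ∩ G.neighborFinset y).card := by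
  have h1 := Finset.card_sdiff_add_card_inter (G.neighborFinset x) (G.neighborFinset y)
  have h2 := Finset.card_erase_add_one
    (show y ∈ G.neighborFinset x \ G.neighborFinset y by simpa using hadj)
  rw [G.card_neighborFinset_eq_degree] at h1
  rw [← h1, ← h2]
  push_cast
  ring

set_option maxHeartbeats 1000000 in
/-- A transport plan prescribed by the masses moved between the classes of neighbors: `y`, the
common neighbors, and the remaining neighbors of `x` on one side, `x` and the remaining neighbors
of `y` on the other, while each common neighbor keeps the mass `1 / d_y`. -/
lemma hasTransport_of_masses (hconn : G.Connected) (hadj : G.Adj x y)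
    {pyx pyY ptx ptY pXx pXY a b t : ℝ} (ha : a = G.degree x) (hb : b = G.degree y)
    (ht : t = (G.neighborFinset x ∩ G.neighborFinset y).card)
    (hyx : 0 ≤ pyx) (hyY : 0 ≤ pyY) (htx : 0 ≤ ptx) (htY : 0 ≤ ptY) (hXx : 0 ≤ pXx)
    (hXY : 0 ≤ pXY) (hy : pyx + pyY = 1 / a) (hT : ptx + ptY = t * (1 / a - 1 / b))
    (hX : pXx + pXY = (a - 1 - t) / a) (hx : pyx + ptx + pXx = 1 / b)
    (hY : pyY + ptY + pXY = (b - 1 - t) / b) :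
    HasTransport (G.neighborFinset x ∪ G.neighborFinset y) (gdist G) (mUnif G x) (mUnif G y)
      (pyx + pyY + ptx + 2 * ptY + pXx + 3 * pXY) := by
  set T := G.neighborFinset x ∩ G.neighborFinset y with hTdef
  set X := (G.neighborFinset x \ G.neighborFinset y).erase y with hXdef
  set Y := (G.neighborFinset y \ G.neighborFinset x).erase x with hYdef
  have hXc : (X.card : ℝ) = a - 1 - t := by
    rw [ha, ht, hXdef, card_private_neighbors hadj]
  have hYc : (Y.card : ℝ) = b - 1 - t := by
    rw [hb, ht, hYdef, card_private_neighbors hadj.symm, hTdef, Finset.inter_comm]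
  have ha0 : 0 < a := by
    rw [ha]; exact_mod_cast (G.degree_pos_iff_exists_adj x).2 ⟨y, hadj⟩
  have hb0 : 0 < b := by
    rw [hb]; exact_mod_cast (G.degree_pos_iff_exists_adj y).2 ⟨x, hadj.symm⟩
  have ht0 : 0 ≤ t := by rw [ht]; positivity
  have mT {u : V} : u ∈ T ↔ G.Adj x u ∧ G.Adj y u := by simp [hTdef]
  have mX {u : V} : u ∈ X ↔ u ≠ y ∧ G.Adj x u ∧ ¬ G.Adj y u := by simp [hXdef]
  have mY {u : V} : u ∈ Y ↔ u ≠ x ∧ G.Adj y u ∧ ¬ G.Adj x u := by simp [hYdef]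
  clear_value T X Y
  have hyS : {y} ⊆ G.neighborFinset x ∪ G.neighborFinset y := by simp [hadj]
  have hxS : {x} ⊆ G.neighborFinset x ∪ G.neighborFinset y := by simp [hadj.symm]
  have hTS : T ⊆ G.neighborFinset x ∪ G.neighborFinset y :=
    fun u hu => by simp [(mT.1 hu).1]
  have hXS : X ⊆ G.neighborFinset x ∪ G.neighborFinset y :=
    fun u hu => by simp [(mX.1 hu).2.1]
  have hYS : Y ⊆ G.neighborFinset x ∪ G.neighborFinset y :=
    fun u hu => by simp [(mY.1 hu).2.1]
  have nT {m : ℝ} (hm : 0 ≤ m) (hle : m ≤ ptx + ptY) (h : m ≠ 0) : T.Nonempty := by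
    rw [Finset.nonempty_iff_ne_empty]
    rintro h0
    rw [h0] at ht
    simp only [Finset.card_empty, Nat.cast_zero] at ht
    rw [hT, ht, zero_mul] at hle
    exact h (le_antisymm hle hm)
  have nX {m : ℝ} (hm : 0 ≤ m) (hle : m ≤ pXx + pXY) (h : m ≠ 0) : X.Nonempty := by
    rw [Finset.nonempty_iff_ne_empty]
    rintro h0
    rw [h0] at hXc
    rw [hX, ← hXc] at hle
    exact h (le_antisymm (by simpa using hle) hm)
  have nY {m : ℝ} (hm : 0 ≤ m) (hle : m ≤ pyY + ptY + pXY) (h : m ≠ 0) : Y.Nonempty := by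
    rw [Finset.nonempty_iff_ne_empty]
    rintro h0
    rw [h0] at hYc
    rw [hY, ← hYc] at hle
    exact h (le_antisymm (by simpa using hle) hm)
  have d1 {u v : V} (h : G.Adj u v) : gdist G u v ≤ 1 := by
    simp [gdist, SimpleGraph.dist_eq_one_iff_adj.2 h]
  have dtri (u v w : V) : gdist G u w ≤ gdist G u v + gdist G v w := by
    unfold gdist; exact_mod_cast hconn.dist_triangle
  have hnx : ¬ G.Adj x x := G.irrefl
  have hny : ¬ G.Adj y y := G.irrefl
  have h0 := hasTransport_unifMass_self (d := gdist G) (fun u => by simp [gdist]) hTS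
    (div_nonneg ht0 hb0.le)
  have h1 := hasTransport_unifMass (d := gdist G) hyS hxS hyx (by simp) (by simp) (k := 1)
    (by simpa using d1 hadj.symm)
  have h2 := hasTransport_unifMass (d := gdist G) hyS hYS hyY (by simp)
    (nY hyY (by linarith)) (k := 1) (by simpa using fun v hv => d1 (mY.1 hv).2.1)
  have h3 := hasTransport_unifMass (d := gdist G) hTS hxS htx (nT htx (by linarith)) (by simp)
    (k := 1) (by simpa using fun u hu => d1 (mT.1 hu).1.symm)
  have h4 := hasTransport_unifMass (d := gdist G) hTS hYS htY (nT htY (by linarith))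
    (nY htY (by linarith)) (k := 2) fun u hu v hv => by
      linarith [dtri u y v, d1 (mT.1 hu).2.symm, d1 (mY.1 hv).2.1]
  have h5 := hasTransport_unifMass (d := gdist G) hXS hxS hXx (nX hXx (by linarith)) (by simp)
    (k := 1) (by simpa using fun u hu => d1 (mX.1 hu).2.1.symm)
  have h6 := hasTransport_unifMass (d := gdist G) hXS hYS hXY (nX hXY (by linarith))
    (nY hXY (by linarith)) (k := 3) fun u hu v hv => by
      linarith [dtri u x v, dtri x y v, d1 (mX.1 hu).2.1.symm, d1 (mY.1 hv).2.1, d1 hadj]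
  have key := ((((((h0.add h1).add h2).add h3).add h4).add h5).add h6).mono
    (c' := pyx + pyY + ptx + 2 * ptY + pXx + 3 * pXY) (by linarith)
  have tpos {u : V} (hu : u ∈ T) : 0 < t := by
    rw [ht]; exact_mod_cast Finset.card_pos.2 ⟨u, hu⟩
  have hTx {u : V} (hu : u ∈ T) : 1 / a = t / b / t + ptx / t + ptY / t := by
    have := (tpos hu).ne'
    rw [add_assoc, ← add_div, hT]
    field_simp
    ring
  have hTy {u : V} (hu : u ∈ T) : 1 / b = t / b / t := by
    have := (tpos hu).ne'
    field_simp
  have hXx' {u : V} (hu : u ∈ X) : 1 / a = pXx / X.card + pXY / X.card := by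
    have : (0 : ℝ) < X.card := by exact_mod_cast Finset.card_pos.2 ⟨u, hu⟩
    rw [← add_div, hX, ← hXc]
    field_simp
  have hYy' {u : V} (hu : u ∈ Y) : 1 / b = pyY / Y.card + ptY / Y.card + pXY / Y.card := by
    have : (0 : ℝ) < Y.card := by exact_mod_cast Finset.card_pos.2 ⟨u, hu⟩
    rw [← add_div, ← add_div, hY, ← hYc]
    field_simp
  clear h0 h1 h2 h3 h4 h5 h6 nT nX nY
  convert key using 1
  · funext u
    simp only [mUnif, unifMass, Pi.add_apply, ← ha, ← ht, Finset.mem_singleton,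
      Finset.card_singleton, Nat.cast_one, div_one]
    by_cases huy : u = y
    · subst huy
      simp [mT, mX, hadj, ← hy]
    · by_cases hux : G.Adj x u
      · by_cases huy' : G.Adj y u
        · have hu := mT.2 ⟨hux, huy'⟩
          simp [hu, mX, hux, huy, huy', hTx hu]
        · have hu := mX.2 ⟨huy, hux, huy'⟩
          simp [hu, mT, hux, huy, huy', hXx' hu]
      · simp [mT, mX, hux, huy]
  · funext u
    simp only [mUnif, unifMass, Pi.add_apply, ← hb, ← ht, Finset.mem_singleton,
      Finset.card_singleton, Nat.cast_one, div_one]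
    by_cases hux : u = x
    · subst hux
      simp [mT, mY, hadj.symm, ← hx]
    · by_cases huy : G.Adj y u
      · by_cases hux' : G.Adj x u
        · have hu := mT.2 ⟨hux', huy⟩
          simpa [hu, mY, hux, huy, hux'] using hTy hu
        · have hu := mY.2 ⟨hux, huy, hux'⟩
          simpa [hu, mT, hux, huy, hux'] using hYy' hu
      · simp [mT, mY, hux, huy]

lemma hasTransport_of_degree_le (hconn : G.Connected) (hadj : G.Adj x y) {a b t : ℝ}
    (ha : a = G.degree x) (hb : b = G.degree y)
    (ht : t = (G.neighborFinset x ∩ G.neighborFinset y).card) (hab : a ≤ b) :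
    HasTransport (G.neighborFinset x ∪ G.neighborFinset y) (gdist G) (mUnif G x) (mUnif G y)
      (1 + max (1 - 1 / a - 1 / b - t / a) 0 + max (1 - 1 / a - 1 / b - t / b) 0 - t / b) := by
  have hX := card_private_neighbors hadj
  rw [← ha, ← ht] at hX
  have ht0 : 0 ≤ t := by rw [ht]; positivity
  have ha0 : 0 < a := by
    have : (0 : ℝ) ≤ a - 1 - t := hX ▸ Nat.cast_nonneg _
    linarith
  have hY := card_private_neighbors hadj.symm
  rw [Finset.inter_comm, ← hb, ← ht] at hY
  have hb0 : 0 < b := ha0.trans_le hab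
  have hXa : (a - 1 - t) / a = 1 - 1 / a - t / a := by field_simp
  have hYb : (b - 1 - t) / b = 1 - 1 / b - t / b := by field_simp
  have hX0 : 0 ≤ (a - 1 - t) / a := div_nonneg (hX ▸ Nat.cast_nonneg _) ha0.le
  have hY0 : 0 ≤ (b - 1 - t) / b := div_nonneg (hY ▸ Nat.cast_nonneg _) hb0.le
  have hT : t * (1 / a - 1 / b) = t / a - t / b := by ring
  have htab : t / b ≤ t / a := div_le_div_of_nonneg_left ht0 ha0 hab
  have ha1 : 0 < 1 / a := by positivity
  have hb1 : 0 < 1 / b := by positivity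
  rw [hXa] at hX0
  rw [hYb] at hY0
  rcases le_total 0 (1 - 1 / a - 1 / b - t / a) with hP | hP
  · rw [max_eq_left hP, max_eq_left (by linarith)]
    refine (hasTransport_of_masses hconn hadj (pyx := 0) (pyY := 1 / a) (ptx := 0)
      (ptY := t / a - t / b) (pXx := 1 / b) (pXY := 1 - 1 / a - 1 / b - t / a)
      ha hb ht ?_ ?_ ?_ ?_ ?_ ?_ ?_ ?_ ?_ ?_ ?_).mono ?_ <;> linarith
  rw [max_eq_right hP]
  rcases le_total 0 (1 - 1 / a - 1 / b - t / b) with hQ | hQ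
  · rw [max_eq_left hQ]
    refine (hasTransport_of_masses hconn hadj (pyx := 0) (pyY := 1 / a)
      (ptx := -(1 - 1 / a - 1 / b - t / a)) (ptY := 1 - 1 / a - 1 / b - t / b)
      (pXx := 1 - 1 / a - t / a) (pXY := 0)
      ha hb ht ?_ ?_ ?_ ?_ ?_ ?_ ?_ ?_ ?_ ?_ ?_).mono ?_ <;> linarith
  · rw [max_eq_right hQ]
    refine (hasTransport_of_masses hconn hadj (pyx := -(1 - 1 / a - 1 / b - t / b))
      (pyY := 1 - 1 / b - t / b) (ptx := t / a - t / b) (ptY := 0)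
      (pXx := 1 - 1 / a - t / a) (pXY := 0)
      ha hb ht ?_ ?_ ?_ ?_ ?_ ?_ ?_ ?_ ?_ ?_ ?_).mono ?_ <;> linarith

end Edge

end ORC

/-- Jost–Liu lower bound with triangle contributions: for adjacent vertices `x, y` with
`#(x,y)` common neighbors,
`Ric(x,y) ≥ -(1 - 1/d_x - 1/d_y - #(x,y)/(d_x ∧ d_y))₊
  - (1 - 1/d_x - 1/d_y - #(x,y)/(d_x ∨ d_y))₊ + #(x,y)/(d_x ∨ d_y)`. -/
theorem jost_liu_triangle_bound {V : Type*} [DecidableEq V] (G : SimpleGraph V)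
    [∀ v, Fintype (G.neighborSet v)] (hconn : G.Connected) (x y : V) (hadj : G.Adj x y) :
    -(max (1 - 1 / (G.degree x : ℝ) - 1 / (G.degree y : ℝ)
        - ((G.neighborFinset x ∩ G.neighborFinset y).card : ℝ)
          / min (G.degree x : ℝ) (G.degree y : ℝ)) 0)
    - (max (1 - 1 / (G.degree x : ℝ) - 1 / (G.degree y : ℝ)
        - ((G.neighborFinset x ∩ G.neighborFinset y).card : ℝ)
          / max (G.degree x : ℝ) (G.degree y : ℝ)) 0)
    + ((G.neighborFinset x ∩ G.neighborFinset y).card : ℝ)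
        / max (G.degree x : ℝ) (G.degree y : ℝ)
      ≤ ricEdge G x y := by
  have hsymm (u v : V) : gdist G u v = gdist G v u := by simp [gdist, SimpleGraph.dist_comm]
  have hd (u v : V) : 0 ≤ gdist G u v := Nat.cast_nonneg _
  unfold ricEdge
  rcases le_total (G.degree x : ℝ) (G.degree y) with h | h
  · rw [min_eq_left h, max_eq_right h]
    have := (hasTransport_of_degree_le hconn hadj rfl rfl rfl h).W1_le hd mUnif_le_one
    linarith
  · rw [min_eq_right h, max_eq_left h]
    have := ((hasTransport_of_degree_le hconn hadj.symm rfl rfl rfl h).symm hsymm).W1_le hd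
      mUnif_le_one
    rw [Finset.inter_comm, sub_right_comm 1 (1 / (G.degree y : ℝ))] at this
    linarith
end
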